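/- Let a deterministic linear loop program over ℝ^n be given by G ∈ ℝ^{m×n}, g ∈ ℝ^m, M ∈ ℝ^{n×n}, c ∈ ℝ^n, with transition relation T = {(x, x') : Gx ≤ g and x' = Mx + c}. Suppose every complex eigenvalue of M (i.e., every root in ℂ of the characteristic polynomial of M) is a nonnegative real number. If the loop is nonterminating (there is an infinite sequence x_1, x_2, … with (x_t, x_{t+1}) ∈ T for all t ≥ 1), then there exists a geometric nontermination argument for the loop of size at most n. -/

import Mathlib

open Matrix Polynomial Filter Topology

/-- A real sequence whose increments are eventually bounded below by a positive constant
tends to infinity. -/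
lemma tendsto_atTop_of_eventually_add_le {v : ℕ → ℝ} {c : ℝ} (hc : 0 < c)
    (h : ∀ᶠ t in atTop, v t + c ≤ v (t + 1)) : Tendsto v atTop atTop := by
  obtain ⟨T, hT⟩ := eventually_atTop.1 h
  have key : ∀ m : ℕ, v T + m * c ≤ v (m + T) := by
    intro m
    induction m with
    | zero => simp
    | succ m ih =>
      have := hT (m + T) (by omega)
      rw [show m + 1 + T = m + T + 1 by ring]
      push_cast
      linarith
  rw [← tendsto_add_atTop_iff_nat T]
  refine tendsto_atTop_mono key (tendsto_atTop_add_const_left _ _ ?_)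
  exact tendsto_natCast_atTop_atTop.atTop_mul_const hc

/-- A linear recurrence of ratio `l` forced by a multiple of `l ^ t` eventually dominates `l ^ t`. -/
lemma eventually_pow_le_of_forced {u : ℕ → ℝ} {l c : ℝ} (hl : 0 < l) (hc : 0 < c)
    (h : ∀ᶠ t in atTop, l * u t + c * l ^ t ≤ u (t + 1)) : ∀ᶠ t in atTop, l ^ t ≤ u t := by
  have hv : Tendsto (fun t => u t / l ^ t) atTop atTop := by
    refine tendsto_atTop_of_eventually_add_le (div_pos hc hl) ?_
    filter_upwards [h] with t ht
    have hp : 0 < l ^ t := pow_pos hl t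
    rw [le_div_iff₀ (pow_pos hl _)]
    calc (u t / l ^ t + c / l) * l ^ (t + 1) = l * u t + c * l ^ t := by
          rw [pow_succ]
          field_simp
      _ ≤ _ := ht
  filter_upwards [hv.eventually_ge_atTop 1] with t ht
  rwa [le_div_iff₀ (pow_pos hl t), one_mul] at ht

/-- Sign dichotomy for a chain of sequences, each driven by its predecessor, with ratios
decreasing and at least `1`. -/
lemma forced_chain_trichotomy {a : ℕ → ℕ → ℝ} {l : ℕ → ℝ} {k : ℕ} (h0 : ∀ t, a 0 t = 0)
    (hrec : ∀ i < k, ∀ t, a (i + 1) (t + 1) = l i * a (i + 1) t + a i t)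
    (hl : ∀ i, 1 ≤ l i) (hanti : Antitone l) :
    ∀ i ≤ k, (∀ j ≤ i, ∀ t, a j t = 0) ∨
      ((∀ j ≤ i, ∀ᶠ t in atTop, a j t ≤ 0) ∧
        ∃ c > 0, ∀ᶠ t in atTop, a i t ≤ -(c * l i ^ t)) ∨
      ∃ c > 0, ∀ᶠ t in atTop, c * l i ^ t ≤ a i t := by
  intro i
  induction i with
  | zero =>
    intro _
    left
    intro j hj t
    obtain rfl : j = 0 := by omega
    exact h0 t
  | succ i ih =>
    intro hi
    have hpos : ∀ j, 0 < l j := fun j => zero_lt_one.trans_le (hl j)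
    have hpow : ∀ t, l (i + 1) ^ t ≤ l i ^ t := fun t =>
      pow_le_pow_left₀ (hpos _).le (hanti (Nat.le_succ i)) t
    rcases ih (by omega) with hz | ⟨hneg, c, hc, hN⟩ | ⟨c, hc, hP⟩
    · have hgeom : ∀ t, a (i + 1) t = a (i + 1) 0 * l i ^ t := by
        intro t
        induction t with
        | zero => simp
        | succ t iht => rw [hrec i hi, hz i le_rfl, iht]; ring
      rcases lt_trichotomy (a (i + 1) 0) 0 with hs | hs | hs
      · right; left
        have hle : ∀ t, a (i + 1) t ≤ -(-a (i + 1) 0 * l (i + 1) ^ t) := by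
          intro t
          rw [hgeom t]
          nlinarith [hpow t]
        refine ⟨fun j hj => ?_, -a (i + 1) 0, by linarith, Eventually.of_forall hle⟩
        rcases Nat.le_succ_iff.1 hj with hj | rfl
        · exact Eventually.of_forall fun t => (hz j hj t).le
        · refine Eventually.of_forall fun t => ?_
          have := mul_pos (neg_pos.2 hs) (pow_pos (hpos (i + 1)) t)
          linarith [hle t]
      · left
        intro j hj t
        rcases Nat.le_succ_iff.1 hj with hj | rfl
        · exact hz j hj t
        · rw [hgeom t, hs, zero_mul]
      · right; right
        refine ⟨a (i + 1) 0, hs, Eventually.of_forall fun t => ?_⟩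
        rw [hgeom t]
        exact mul_le_mul_of_nonneg_left (hpow t) hs.le
    · right; left
      have hle : ∀ᶠ t in atTop, a (i + 1) t ≤ -(1 * l (i + 1) ^ t) := by
        have := eventually_pow_le_of_forced (u := fun t => -a (i + 1) t) (hpos i) hc (by
          filter_upwards [hN] with t ht
          rw [hrec i hi]
          linarith)
        filter_upwards [this] with t ht
        linarith [hpow t]
      refine ⟨fun j hj => ?_, 1, one_pos, hle⟩
      rcases Nat.le_succ_iff.1 hj with hj | rfl
      · exact hneg j hj
      · filter_upwards [hle] with t ht
        linarith [pow_pos (hpos (i + 1)) t]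
    · right; right
      have := eventually_pow_le_of_forced (u := fun t => a (i + 1) t) (hpos i) hc (by
          filter_upwards [hP] with t ht
          rw [hrec i hi]
          linarith)
      refine ⟨1, one_pos, ?_⟩
      filter_upwards [this] with t ht
      linarith [hpow t]

/-- If the final member of a forced chain is the increment of `u`, and `u` is a vanishing
perturbation of a sequence bounded above by `b`, then eventually `u` is bounded above by `b` and
all members of the chain are nonpositive. -/
lemma eventually_nonpos_of_forced_chain {a : ℕ → ℕ → ℝ} {l : ℕ → ℝ} {k : ℕ} {u w : ℕ → ℝ} {b : ℝ}
    (h0 : ∀ t, a 0 t = 0)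
    (hrec : ∀ i < k, ∀ t, a (i + 1) (t + 1) = l i * a (i + 1) t + a i t)
    (hl : ∀ i, 1 ≤ l i) (hanti : Antitone l) (hu : ∀ t, u (t + 1) = u t + a k t)
    (hw : Tendsto w atTop (𝓝 0)) (hb : ∀ t, u t + w t ≤ b) :
    ∀ᶠ t in atTop, u t ≤ b ∧ ∀ j ≤ k, a j t ≤ 0 := by
  rcases forced_chain_trichotomy h0 hrec hl hanti k le_rfl with hz | ⟨hneg, c, hc, hN⟩ | ⟨c, hc, hP⟩
  · have hconst : ∀ t, u t = u 0 := by
      intro t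
      induction t with
      | zero => rfl
      | succ t ih => rw [hu, hz k le_rfl, ih, add_zero]
    have hlim : u 0 ≤ b := by
      have : Tendsto (fun t => u 0 + w t) atTop (𝓝 (u 0 + 0)) := hw.const_add _
      rw [add_zero] at this
      exact le_of_tendsto' this fun t => by rw [← hconst t]; exact hb t
    exact Eventually.of_forall fun t => ⟨(hconst t).le.trans hlim, fun j hj => (hz j hj t).le⟩
  · have hdown : Tendsto (fun t => -u t) atTop atTop := by
      refine tendsto_atTop_of_eventually_add_le hc ?_
      filter_upwards [hN] with t ht
      have : c ≤ c * l k ^ t := le_mul_of_one_le_right hc.le (one_le_pow₀ (hl k))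
      rw [hu]
      linarith
    have hall : ∀ᶠ t in atTop, ∀ j ∈ Set.Iic k, a j t ≤ 0 :=
      (eventually_all_finite (Set.finite_Iic k)).2 fun j hj => hneg j hj
    filter_upwards [hdown.eventually_ge_atTop (-b), hall] with t ht ha
    exact ⟨by linarith, fun j hj => ha j hj⟩
  · exfalso
    have hup : Tendsto u atTop atTop := by
      refine tendsto_atTop_of_eventually_add_le hc ?_
      filter_upwards [hP] with t ht
      have : c ≤ c * l k ^ t := le_mul_of_one_le_right hc.le (one_le_pow₀ (hl k))
      rw [hu]
      linarith
    obtain ⟨t, ht, hwt⟩ := ((hup.eventually_gt_atTop (b + 1)).and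
      (hw.eventually_const_lt (show (-1 : ℝ) < 0 by norm_num))).exists
    linarith [hb t]

/-- A contracting linear recurrence with vanishing forcing term tends to zero. -/
lemma tendsto_zero_of_contracting_forced {E : Type*} [NormedAddCommGroup E] [NormedSpace ℝ E]
    {u v : ℕ → E} {r : ℝ} (hr0 : 0 ≤ r) (hr1 : r < 1)
    (h : ∀ t, u (t + 1) = r • u t + v t) (hv : Tendsto v atTop (𝓝 0)) :
    Tendsto u atTop (𝓝 0) := by
  refine Metric.tendsto_atTop.2 fun ε hε => ?_
  have hε' : 0 < (1 - r) * (ε / 2) := mul_pos (by linarith) (by linarith)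
  obtain ⟨T, hT⟩ := Metric.tendsto_atTop.1 hv _ hε'
  have key : ∀ m : ℕ, ‖u (m + T)‖ ≤ r ^ m * ‖u T‖ + ε / 2 := by
    intro m
    induction m with
    | zero => simpa using (half_pos hε).le
    | succ m ih =>
      rw [show m + 1 + T = m + T + 1 by ring, h]
      have h1 := norm_add_le (r • u (m + T)) (v (m + T))
      rw [norm_smul, Real.norm_of_nonneg hr0] at h1
      have h2 := hT (m + T) (by omega)
      rw [dist_zero_right] at h2
      have h3 := mul_le_mul_of_nonneg_left ih hr0
      rw [pow_succ]
      linarith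
  have hlim : Tendsto (fun m : ℕ => r ^ m * ‖u T‖) atTop (𝓝 0) := by
    simpa using (tendsto_pow_atTop_nhds_zero_of_lt_one hr0 hr1).mul_const ‖u T‖
  obtain ⟨N, hN⟩ := eventually_atTop.1 (hlim.eventually_lt_const (half_pos hε))
  refine ⟨N + T, fun t ht => ?_⟩
  obtain ⟨m, rfl⟩ : ∃ m, t = m + T := ⟨t - T, by omega⟩
  rw [dist_zero_right]
  linarith [key m, hN m (by omega)]

lemma aeval_mul_mulVec {ι : Type*} [Fintype ι] [DecidableEq ι] (M : Matrix ι ι ℝ) (p q : ℝ[X])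
    (v : ι → ℝ) : aeval M (p * q) *ᵥ v = aeval M p *ᵥ (aeval M q *ᵥ v) := by
  rw [map_mul, mulVec_mulVec]

lemma aeval_X_sub_C_mulVec {ι : Type*} [Fintype ι] [DecidableEq ι] (M : Matrix ι ι ℝ) (r : ℝ)
    (v : ι → ℝ) : aeval M (X - C r) *ᵥ v = M *ᵥ v - r • v := by
  rw [map_sub, aeval_X, aeval_C, sub_mulVec, Algebra.algebraMap_eq_smul_one, smul_mulVec,
    one_mulVec]

lemma pow_mulVec_mulVec_comm {ι : Type*} [Fintype ι] [DecidableEq ι] (M : Matrix ι ι ℝ) (t : ℕ)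
    (v : ι → ℝ) : M ^ t *ᵥ (M *ᵥ v) = M *ᵥ (M ^ t *ᵥ v) := by
  rw [mulVec_mulVec, mulVec_mulVec, ← pow_succ, ← pow_succ']

lemma pow_succ_mulVec {ι : Type*} [Fintype ι] [DecidableEq ι] (M : Matrix ι ι ℝ) (t : ℕ)
    (v : ι → ℝ) : M ^ (t + 1) *ᵥ v = M *ᵥ (M ^ t *ᵥ v) := by
  rw [mulVec_mulVec, ← pow_succ']

/-- Vectors annihilated by a polynomial in `M` with all roots in `[0, 1)` are attracted to zero. -/
lemma tendsto_pow_mulVec_zero {ι : Type*} [Fintype ι] [DecidableEq ι] (M : Matrix ι ι ℝ)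
    (s : Multiset ℝ) (hs : ∀ r ∈ s, 0 ≤ r ∧ r < 1) (v : ι → ℝ)
    (hv : aeval M (s.map fun r => X - C r).prod *ᵥ v = 0) :
    Tendsto (fun t => M ^ t *ᵥ v) atTop (𝓝 0) := by
  induction s using Multiset.induction_on generalizing v with
  | empty =>
    have : v = 0 := by simpa using hv
    simp [this]
  | cons r s ih =>
    rw [Multiset.map_cons, Multiset.prod_cons, mul_comm, aeval_mul_mulVec,
      aeval_X_sub_C_mulVec] at hv
    have hlim := ih (fun q hq => hs q (Multiset.mem_cons_of_mem hq)) _ hv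
    obtain ⟨hr0, hr1⟩ := hs r (Multiset.mem_cons_self r s)
    refine tendsto_zero_of_contracting_forced hr0 hr1 (fun t => ?_) hlim
    rw [pow_succ_mulVec, mulVec_sub, mulVec_smul, pow_mulVec_mulVec_comm]
    abel

lemma isCoprime_multiset_prod_X_sub_C {K : Type*} [Field K] (s : Multiset K) (p : K[X])
    (h : ∀ r ∈ s, IsCoprime (X - C r) p) : IsCoprime (s.map fun r => X - C r).prod p := by
  induction s using Multiset.induction_on with
  | empty => simpa using isCoprime_one_left
  | cons r s ih =>
    rw [Multiset.map_cons, Multiset.prod_cons]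
    exact (h r (Multiset.mem_cons_self r s)).mul_left
      (ih fun q hq => h q (Multiset.mem_cons_of_mem hq))

/-- The characteristic polynomial of a real matrix whose complex eigenvalues are all nonnegative
real numbers is a product of real linear factors with nonnegative roots. -/
lemma charpoly_splits_of_complex_eigenvalues_nonneg {n : ℕ} (M : Matrix (Fin n) (Fin n) ℝ)
    (heig : ∀ z : ℂ, ((M.map (Complex.ofReal ·)).charpoly).IsRoot z → z.im = 0 ∧ 0 ≤ z.re) :
    ∃ s : Multiset ℝ, M.charpoly = (s.map fun r => X - C r).prod ∧ s.card = n ∧ ∀ r ∈ s, 0 ≤ r := by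
  have hmap : (M.map (Complex.ofReal ·)).charpoly = M.charpoly.map Complex.ofRealHom :=
    charpoly_map M Complex.ofRealHom
  have hne : M.charpoly ≠ 0 := (charpoly_monic M).ne_zero
  have hsplits : M.charpoly.Splits := by
    refine Splits.of_splits_map Complex.ofRealHom (IsAlgClosed.splits _) fun z hz => ?_
    have hroot := isRoot_of_mem_roots hz
    rw [← hmap] at hroot
    exact ⟨z.re, Complex.ext rfl (heig z hroot).1.symm⟩
  refine ⟨M.charpoly.roots, hsplits.eq_prod_roots_of_monic (charpoly_monic M), ?_, fun r hr => ?_⟩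
  · rw [← hsplits.natDegree_eq_card_roots, charpoly_natDegree_eq_dim, Fintype.card_fin]
  · have hroot : ((M.map (Complex.ofReal ·)).charpoly).IsRoot (r : ℂ) := by
      rw [hmap]
      exact (isRoot_of_mem_roots hr).map
    simpa using (heig r hroot).2

/-- The members of a finite multiset of reals that are at least `1`, enumerated in decreasing
order and continued by the constant `1`. -/
lemma exists_antitone_enumeration (s : Multiset ℝ) (hs : ∀ r ∈ s, 1 ≤ r) :
    ∃ l : ℕ → ℝ, Antitone l ∧ (∀ i, 1 ≤ l i) ∧
      (s.map fun r => X - C r).prod = ∏ i ∈ Finset.range s.card, (X - C (l i)) := by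
  set L := s.sort (· ≥ ·) with hL
  have hLs : (L : Multiset ℝ) = s := s.sort_eq (· ≥ ·)
  have hlen : L.length = s.card := by rw [← hLs, Multiset.coe_card]
  have hge : ∀ i, 1 ≤ L.getD i 1 := by
    intro i
    by_cases hi : i < L.length
    · rw [List.getD_eq_getElem _ _ hi]
      exact hs _ (by rw [← hLs]; exact List.getElem_mem hi)
    · rw [List.getD_eq_default _ _ (not_lt.1 hi)]
  refine ⟨fun i => L.getD i 1, fun i j hij => ?_, hge, ?_⟩
  · by_cases hj : j < L.length
    · simp only
      rw [List.getD_eq_getElem _ _ hj, List.getD_eq_getElem _ _ (hij.trans_lt hj)]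
      rcases hij.eq_or_lt with rfl | hlt
      · exact le_rfl
      · exact List.pairwise_iff_getElem.1 (s.pairwise_sort (· ≥ ·)) i j _ hj hlt
    · simp only
      rw [List.getD_eq_default _ _ (not_lt.1 hj)]
      exact hge i
  · rw [← hlen, ← hLs, Multiset.map_coe, Multiset.prod_coe, Finset.prod_range,
      ← List.prod_ofFn]
    congr 1
    apply List.ext_getElem
    · simp
    · intro i h1 h2
      simp

/-- An affine orbit whose linear part has nonnegative real spectrum is, up to a vanishing
perturbation, an affine orbit whose increment is annihilated by the factors belonging to the
eigenvalues that are at least `1`. -/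
lemma exists_orbit_with_expanding_increment {n : ℕ} (M : Matrix (Fin n) (Fin n) ℝ)
    (c : Fin n → ℝ) (s : Multiset ℝ) (hs : M.charpoly = (s.map fun r => X - C r).prod)
    (hs0 : ∀ r ∈ s, 0 ≤ r) (x : ℕ → Fin n → ℝ) (hx : ∀ t, x (t + 1) = M *ᵥ x t + c) :
    ∃ z w : ℕ → Fin n → ℝ, (∀ t, x t = z t + w t) ∧ (∀ t, z (t + 1) = M *ᵥ z t + c) ∧
      Tendsto w atTop (𝓝 0) ∧
      aeval M ((s.filter (1 ≤ ·)).map fun r => X - C r).prod *ᵥ (z 1 - z 0) = 0 := by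
  set P := ((s.filter (1 ≤ ·)).map fun r => X - C r).prod with hP
  set Q := ((s.filter fun r => ¬ 1 ≤ r).map fun r => X - C r).prod with hQ
  have hPQ : P * Q = M.charpoly := by
    rw [hs, hP, hQ, ← Multiset.prod_add, ← Multiset.map_add, Multiset.filter_add_not]
  have hann : ∀ v, aeval M (P * Q) *ᵥ v = 0 := fun v => by
    rw [hPQ, aeval_self_charpoly, zero_mulVec]
  have hcop : IsCoprime Q ((X - C 1) * P) := by
    refine isCoprime_multiset_prod_X_sub_C _ _ fun r hr => ?_
    have hr1 : r < 1 := not_le.1 (Multiset.mem_filter.1 hr).2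
    have hlin : ∀ q : ℝ, 1 ≤ q → IsCoprime (X - C q : ℝ[X]) (X - C r) := fun q hq =>
      isCoprime_X_sub_C_of_isUnit_sub (sub_ne_zero.2 (hr1.trans_le hq).ne').isUnit
    exact ((hlin 1 le_rfl).mul_left
      (isCoprime_multiset_prod_X_sub_C _ _ fun q hq => hlin q (Multiset.mem_filter.1 hq).2)).symm
  obtain ⟨A, B, hAB⟩ := hcop
  set d := x 1 - x 0 with hd
  set w := aeval M (B * P) *ᵥ d with hw
  refine ⟨fun t => x t - M ^ t *ᵥ w, fun t => M ^ t *ᵥ w, fun t => (sub_add_cancel _ _).symm,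
    fun t => ?_, ?_, ?_⟩
  · simp only
    rw [hx, pow_succ_mulVec, mulVec_sub]
    abel
  · refine tendsto_pow_mulVec_zero M (s.filter fun r => ¬ 1 ≤ r) (fun r hr => ?_) w ?_
    · exact ⟨hs0 r (Multiset.mem_filter.1 hr).1, not_le.1 (Multiset.mem_filter.1 hr).2⟩
    · rw [← hQ, hw, ← aeval_mul_mulVec, show Q * (B * P) = B * (P * Q) by ring,
        aeval_mul_mulVec, hann, mulVec_zero]
  · have hinc : x 1 - M ^ 1 *ᵥ w - (x 0 - M ^ 0 *ᵥ w) = aeval M (A * Q) *ᵥ d := by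
      have h1 : aeval M (X - C 1 : ℝ[X]) *ᵥ w = M *ᵥ w - w := by
        rw [aeval_X_sub_C_mulVec, one_smul]
      have h2 : aeval M (A * Q) *ᵥ d + aeval M (X - C 1 : ℝ[X]) *ᵥ w = d := by
        rw [hw, ← aeval_mul_mulVec, ← add_mulVec, ← map_add,
          show A * Q + (X - C 1) * (B * P) = 1 by rw [← hAB]; ring, map_one, one_mulVec]
      rw [pow_one, pow_zero, one_mulVec]
      rw [h1] at h2
      rw [← sub_eq_iff_eq_add'.2 (h2.symm.trans (add_comm _ _)), hd]
      abel
    simp only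
    rw [hinc, ← aeval_mul_mulVec, show P * (A * Q) = A * (P * Q) by ring, aeval_mul_mulVec,
      hann, mulVec_zero]

/-- **Completeness.**
If the deterministic linear loop program `while (Gx ≤ g) do x := Mx + c` is
nonterminating and every complex eigenvalue of `M` is a nonnegative real number,
then it has a geometric nontermination argument of size at most `n`. -/
theorem gnta_completeness {n m : ℕ}
    (G : Matrix (Fin m) (Fin n) ℝ) (g : Fin m → ℝ)
    (M : Matrix (Fin n) (Fin n) ℝ) (c : Fin n → ℝ)
    -- every complex eigenvalue of `M` is a nonnegative real number
    (heig : ∀ z : ℂ, ((M.map (Complex.ofReal ·)).charpoly).IsRoot z → z.im = 0 ∧ 0 ≤ z.re)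
    -- the loop is nonterminating: there is an infinite execution
    (x : ℕ → Fin n → ℝ)
    (hexec : ∀ t : ℕ, G *ᵥ x t ≤ g ∧ x (t + 1) = M *ᵥ x t + c) :
    -- there is a geometric nontermination argument of size `k ≤ n`
    ∃ k : ℕ, k ≤ n ∧
      ∃ (x1 : Fin n → ℝ) (y : Fin k → Fin n → ℝ)
        (lam : Fin k → ℝ) (mu : Fin (k - 1) → ℝ),
        -- (domain)
        (∀ i, 0 ≤ lam i) ∧ (∀ i, 0 ≤ mu i) ∧
        -- (point): A (x₁ ; x₁ + Σᵢ yᵢ) ≤ b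
        (G *ᵥ x1 ≤ g ∧ x1 + ∑ i, y i = M *ᵥ x1 + c) ∧
        -- (ray): A (yᵢ ; λᵢ yᵢ + μ_{i-1} y_{i-1}) ≤ 0
        (∀ i : Fin k, G *ᵥ y i ≤ 0 ∧
          (lam i • y i +
            if h : 0 < (i : ℕ) then
              mu ⟨(i : ℕ) - 1, by have := i.isLt; omega⟩ •
                y ⟨(i : ℕ) - 1, by have := i.isLt; omega⟩
            else 0) = M *ᵥ y i) := by
  obtain ⟨s, hs, hcard, hs0⟩ := charpoly_splits_of_complex_eigenvalues_nonneg M heig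
  obtain ⟨z, w, hxz, hz, hw, hann⟩ :=
    exists_orbit_with_expanding_increment M c s hs hs0 x fun t => (hexec t).2
  obtain ⟨l, hanti, hl, hprod⟩ := exists_antitone_enumeration (s.filter (1 ≤ ·))
    fun r hr => (Multiset.mem_filter.1 hr).2
  set k := (s.filter (1 ≤ ·)).card with hk
  have hkn : k ≤ n := hcard ▸ Multiset.card_le_card (Multiset.filter_le _ s)
  rw [hprod] at hann
  let e : ℕ → Fin n → ℝ := fun i => aeval M (∏ j ∈ Finset.Ico i k, (X - C (l j))) *ᵥ (z 1 - z 0)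
  have he0 : e 0 = 0 := by simpa [e, ← Finset.range_eq_Ico] using hann
  have hek : e k = z 1 - z 0 := by simp [e]
  have hMe : ∀ i < k, M *ᵥ e (i + 1) = l i • e (i + 1) + e i := by
    intro i hi
    have : e i = M *ᵥ e (i + 1) - l i • e (i + 1) := by
      simp only [e]
      rw [Finset.prod_eq_prod_Ico_succ_bot hi, aeval_mul_mulVec, aeval_X_sub_C_mulVec]
    rw [this]
    abel
  let E : ℕ → ℕ → Fin n → ℝ := fun t i => M ^ t *ᵥ e i
  have hE0 : ∀ t, E t 0 = 0 := fun t => by simp [E, he0]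
  have hME : ∀ t, ∀ i < k, M *ᵥ E t (i + 1) = l i • E t (i + 1) + E t i := by
    intro t i hi
    simp only [E]
    rw [← pow_mulVec_mulVec_comm, hMe i hi, mulVec_add, mulVec_smul]
  have hzE : ∀ t, z (t + 1) = z t + E t k := by
    intro t
    induction t with
    | zero => simp [E, hek]
    | succ t ih =>
      have h1 : E (t + 1) k = M *ᵥ E t k := pow_succ_mulVec M t _
      rw [hz (t + 1), h1]
      conv_lhs => rw [ih]
      rw [mulVec_add, hz t]
      abel
  have hrow : ∀ r : Fin m, ∀ᶠ t in atTop,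
      (G *ᵥ z t) r ≤ g r ∧ ∀ j ≤ k, (G *ᵥ E t j) r ≤ 0 := by
    intro r
    refine eventually_nonpos_of_forced_chain (a := fun j t => (G *ᵥ E t j) r)
      (w := fun t => (G *ᵥ w t) r) (l := l) (fun t => by simp [hE0]) (fun i hi t => ?_) hl hanti
      (fun t => ?_) ?_ (fun t => ?_)
    · have h1 : E (t + 1) (i + 1) = M *ᵥ E t (i + 1) := pow_succ_mulVec M t _
      rw [h1, hME t i hi, mulVec_add, mulVec_smul]
      simp
    · rw [hzE t, mulVec_add, Pi.add_apply]
    · have hcont : Continuous fun v : Fin n → ℝ => (G *ᵥ v) r := by fun_prop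
      simpa [Function.comp_def] using (hcont.tendsto 0).comp hw
    · have h1 := (hexec t).1 r
      rwa [hxz t, mulVec_add] at h1
  obtain ⟨T, hT⟩ := (eventually_all.2 hrow).exists
  have hlpos : ∀ i, 0 < l i := fun i => zero_lt_one.trans_le (hl i)
  have hGE : ∀ j ≤ k, G *ᵥ E T j ≤ 0 := fun j hj r => (hT r).2 j hj
  refine ⟨k, hkn, z T + ∑ i : Fin k, E T (i + 1), fun i => l i • E T (i + 1), fun i => l i,
    fun i => l (i + 1) / l i, fun i => (hlpos i).le, fun i => (div_pos (hlpos _) (hlpos _)).le,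
    ⟨?_, ?_⟩, fun i => ⟨?_, ?_⟩⟩
  · rw [mulVec_add, mulVec_sum]
    have h1 : ∑ i : Fin k, G *ᵥ E T (i + 1) ≤ 0 :=
      Finset.sum_nonpos fun i _ => hGE _ i.isLt
    have h2 : G *ᵥ z T ≤ g := fun r => (hT r).1
    simpa using add_le_add h2 h1
  · have h1 : ∑ i : Fin k, M *ᵥ E T (i + 1)
        = ∑ i : Fin k, l i • E T (i + 1) + ∑ i : Fin k, E T i := by
      rw [← Finset.sum_add_distrib]
      exact Finset.sum_congr rfl fun i _ => hME T i i.isLt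
    have h2 : ∑ i : Fin k, E T (i + 1) - ∑ i : Fin k, E T i = E T k := by
      rw [Fin.sum_univ_eq_sum_range (fun i => E T (i + 1)), Fin.sum_univ_eq_sum_range (E T),
        ← Finset.sum_sub_distrib, Finset.sum_range_sub, hE0, sub_zero]
    have h3 : M *ᵥ z T + c = z T + E T k := by rw [← hz, hzE]
    rw [mulVec_add, mulVec_sum, h1, add_right_comm (M *ᵥ z T), h3, ← h2]
    abel
  · rw [mulVec_smul]
    exact smul_nonpos_of_nonneg_of_nonpos (hlpos i).le (hGE _ i.isLt)
  · rw [mulVec_smul, hME T i i.isLt, smul_add]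
    congr 1
    split_ifs with h
    · have hi : (i : ℕ) - 1 + 1 = i := by omega
      simp only
      rw [hi, smul_smul, div_mul_cancel₀ _ (hlpos _).ne']
    · have hi : (i : ℕ) = 0 := by omega
      rw [hi, hE0, smul_zero]
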